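/- Suppose ||Z_1 - Z_3|| = ||Z_2 - Z_3||, d_1 = d_2 > ||Z_1 - Z_3||, and d_3² = d_1² - ||Z_1 - Z_3||². With r = ||Z_1 Z_2|| and s = ||Z_3 - (Z_1+Z_2)/2||, the objective value at the intersection point S_{31-} of circles S_3 and S_1 farthest from Z_2 satisfies O(S_{31-}) = (2 r s d_3) / sqrt(s² + r²/4). -/

import Mathlib

theorem EuclideanSpace.dist_sq_fin_two (x y : EuclideanSpace ℝ (Fin 2)) :
    dist x y ^ 2 = (x 0 - y 0) ^ 2 + (x 1 - y 1) ^ 2 := by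
  rw [EuclideanSpace.dist_eq, Real.sq_sqrt (by positivity), Fin.sum_univ_two, Real.dist_eq,
    Real.dist_eq, sq_abs, sq_abs]

/-- If `S` is orthogonal to `a` in the plane, then the component of `b` along `S` is governed by
the cross product of `a` and `b`. -/
theorem sq_dot_mul_sq_norm_of_dot_eq_zero {a₀ a₁ b₀ b₁ x y : ℝ} (h : x * a₀ + y * a₁ = 0) :
    (x * b₀ + y * b₁) ^ 2 * (a₀ ^ 2 + a₁ ^ 2) =
      (x ^ 2 + y ^ 2) * (a₀ * b₁ - a₁ * b₀) ^ 2 := by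
  linear_combination
    (2 * (a₀ * b₀ + a₁ * b₁) * (x * b₀ + y * b₁) - (x * a₀ + y * a₁) * (b₀ ^ 2 + b₁ ^ 2)) * h

theorem stmt_9 (Z₁ Z₂ Z₃ S₃₁m : EuclideanSpace ℝ (Fin 2)) (d₁ d₂ d₃ r s : ℝ)
    (hiso : dist Z₁ Z₃ = dist Z₂ Z₃) (hd : d₁ = d₂)
    (hd₁ : dist Z₁ Z₃ < d₁)
    (hd₃ : d₃ = Real.sqrt (d₁ ^ 2 - dist Z₁ Z₃ ^ 2))
    (hr : r = dist Z₁ Z₂) (hs : s = dist Z₃ ((2 : ℝ)⁻¹ • (Z₁ + Z₂)))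
    (hm₃ : dist S₃₁m Z₃ = d₃) (hm₁ : dist S₃₁m Z₁ = d₁)
    (hmmax : ∀ P, dist P Z₃ = d₃ → dist P Z₁ = d₁ → dist Z₂ P ≤ dist Z₂ S₃₁m)
    (O : EuclideanSpace ℝ (Fin 2) → ℝ)
    (hO : ∀ W, O W = |d₁ ^ 2 - dist W Z₁ ^ 2| + |d₂ ^ 2 - dist W Z₂ ^ 2| +
      |d₃ ^ 2 - dist W Z₃ ^ 2|) :
    O S₃₁m = 2 * r * s * d₃ / Real.sqrt (s ^ 2 + r ^ 2 / 4) := by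
  subst hd
  have hL : 0 ≤ dist Z₁ Z₃ := dist_nonneg
  have hd₃sq : d₃ ^ 2 = d₁ ^ 2 - dist Z₁ Z₃ ^ 2 := by
    rw [hd₃, Real.sq_sqrt (by nlinarith)]
  have hd₃0 : 0 ≤ d₃ := hd₃ ▸ Real.sqrt_nonneg _
  have hr0 : 0 ≤ r := hr ▸ dist_nonneg
  have hs0 : 0 ≤ s := hs ▸ dist_nonneg
  have hiso2 : dist Z₁ Z₃ ^ 2 = dist Z₂ Z₃ ^ 2 := by rw [hiso]
  have hr2 : r ^ 2 = dist Z₁ Z₂ ^ 2 := by rw [hr]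
  have hs2 : s ^ 2 = dist Z₃ ((2 : ℝ)⁻¹ • (Z₁ + Z₂)) ^ 2 := by rw [hs]
  have hm₃2 : dist S₃₁m Z₃ ^ 2 = d₃ ^ 2 := by rw [hm₃]
  have hm₁2 : dist S₃₁m Z₁ ^ 2 = d₁ ^ 2 := by rw [hm₁]
  have hL2 := EuclideanSpace.dist_sq_fin_two Z₁ Z₃
  have hSZ₂ := EuclideanSpace.dist_sq_fin_two S₃₁m Z₂
  rw [EuclideanSpace.dist_sq_fin_two] at hr2 hs2 hm₃2 hm₁2
  rw [hL2, EuclideanSpace.dist_sq_fin_two] at hiso2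
  simp only [PiLp.smul_apply, PiLp.add_apply, smul_eq_mul] at hs2
  have hsqrt : Real.sqrt (s ^ 2 + r ^ 2 / 4) = dist Z₁ Z₃ := by
    rw [Real.sqrt_eq_iff_mul_self_eq (by positivity) hL]
    linear_combination hs2 + hr2 / 4 - hL2 - hiso2 / 2
  have hO' : O S₃₁m = |d₁ ^ 2 - dist S₃₁m Z₂ ^ 2| := by
    rw [hO, hm₃, hm₁]; simp
  rw [hO', hsqrt]
  rcases hL.eq_or_lt with h0 | hpos
  · have h12 : Z₁ = Z₂ :=
      (dist_eq_zero.1 h0.symm).trans (dist_eq_zero.1 (hiso ▸ h0.symm)).symm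
    rw [← h12, hm₁, ← h0]; simp
  rw [eq_div_iff hpos.ne', ← sq_eq_sq₀ (by positivity) (by positivity), mul_pow, sq_abs]
  have horth : (S₃₁m 0 - Z₃ 0) * (Z₁ 0 - Z₃ 0) + (S₃₁m 1 - Z₃ 1) * (Z₁ 1 - Z₃ 1) = 0 := by
    linear_combination (hm₃2 - hm₁2 + hd₃sq - hL2) / 2
  have hkey := sq_dot_mul_sq_norm_of_dot_eq_zero (b₀ := Z₂ 0 - Z₃ 0) (b₁ := Z₂ 1 - Z₃ 1) horth
  rw [hm₃2, ← hL2] at hkey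
  have hdot : d₁ ^ 2 - dist S₃₁m Z₂ ^ 2 =
      2 * ((S₃₁m 0 - Z₃ 0) * (Z₂ 0 - Z₃ 0) + (S₃₁m 1 - Z₃ 1) * (Z₂ 1 - Z₃ 1)) := by
    linear_combination -hSZ₂ - hm₃2 - hd₃sq + hL2 + hiso2
  have hrs : r ^ 2 * s ^ 2 = ((Z₁ 0 - Z₃ 0) * (Z₂ 1 - Z₃ 1)
      - (Z₁ 1 - Z₃ 1) * (Z₂ 0 - Z₃ 0)) ^ 2 := by
    rw [hr2, hs2]
    linear_combination (((Z₁ 0 - Z₃ 0) ^ 2 + (Z₁ 1 - Z₃ 1) ^ 2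
      - (Z₂ 0 - Z₃ 0) ^ 2 - (Z₂ 1 - Z₃ 1) ^ 2) / 4) * hiso2
  rw [hdot]
  linear_combination 4 * hkey - 4 * d₃ ^ 2 * hrs
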